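/- Fix n ∈ ℕ. Let σ be a strongly convex rational polyhedral cone in ℝⁿ and W ⊊ ℂⁿ a proper complex vector subspace. Then the following are equivalent: (i) every face τ of σ satisfies [Relint(τ) ∩ W ∩ ℤⁿ ≠ ∅ if and only if τ ⊆ W]; (ii) the set L ∩ σ is a face of σ, where L := span_ℝ(W ∩ ℤⁿ) ⊆ ℝⁿ is the real linear span of the lattice points of W. -/

import Mathlib

open scoped BigOperators

noncomputable section

/-- Image of an integer vector in `ℝⁿ`. -/
def intToR {n : ℕ} (m : Fin n → ℤ) : Fin n → ℝ := fun i => (m i : ℝ)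

/-- Image of an integer vector in `ℂⁿ`. -/
def intToC {n : ℕ} (m : Fin n → ℤ) : Fin n → ℂ := fun i => (m i : ℂ)

/-- Image of a real vector in `ℂⁿ`. -/
def toC {n : ℕ} (x : Fin n → ℝ) : Fin n → ℂ := fun i => (x i : ℂ)

/-- The cone `Cone(v₁, …, v_k) = {∑ cᵢ vᵢ : cᵢ ≥ 0} ⊆ ℝⁿ`. -/
def coneOf {n k : ℕ} (v : Fin k → (Fin n → ℝ)) : Set (Fin n → ℝ) :=
  {x | ∃ c : Fin k → ℝ, (∀ i, 0 ≤ c i) ∧ x = ∑ i, c i • v i}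

/-- The cone generated by the vectors `vⱼ` for `j` in a subset `J` of the index set. -/
def coneOfSub {n k : ℕ} (v : Fin k → (Fin n → ℝ)) (J : Set (Fin k)) : Set (Fin n → ℝ) :=
  {x | ∃ c : Fin k → ℝ, (∀ i, 0 ≤ c i) ∧ (∀ i, i ∉ J → c i = 0) ∧ x = ∑ i, c i • v i}

/-- `σ ⊆ W`: every point of `σ ⊆ ℝⁿ` lies (after complexification) in the
complex subspace `W ⊆ ℂⁿ`. -/
def subsetW {n : ℕ} (σ : Set (Fin n → ℝ)) (W : Submodule ℂ (Fin n → ℂ)) : Prop :=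
  ∀ x ∈ σ, toC x ∈ W

/-- `Relint(σ) ∩ W ∩ ℤⁿ ≠ ∅`: there is a lattice point in the relative interior of `σ`
lying in `W`.  The relative interior is the intrinsic interior (interior within the
affine span). -/
def relintMeetsLattice {n : ℕ} (σ : Set (Fin n → ℝ)) (W : Submodule ℂ (Fin n → ℂ)) : Prop :=
  ∃ m : Fin n → ℤ, intToR m ∈ intrinsicInterior ℝ σ ∧ intToC m ∈ W

/-- `τ` is a face of `σ`: `τ = σ ∩ {f = 0}` for an `ℝ`-linear functional `f`
nonnegative on `σ`. -/
def IsFaceOf {n : ℕ} (τ σ : Set (Fin n → ℝ)) : Prop :=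
  ∃ f : (Fin n → ℝ) →ₗ[ℝ] ℝ, (∀ x ∈ σ, 0 ≤ f x) ∧ τ = σ ∩ {x | f x = 0}


lemma aux_exists_pos_rat {k : ℕ} (c : Fin k → ℝ) :
    ∃ φ : ℝ →ₗ[ℚ] ℚ, ∀ j, 0 < c j → 0 < φ (c j) := by
  classical
  let E := Submodule.span ℚ (Set.range c)
  have hmem : ∀ j, c j ∈ E := fun j => Submodule.subset_span ⟨j, rfl⟩
  haveI : Module.Finite ℚ E := Module.Finite.span_of_finite ℚ (Set.finite_range c)
  let b := Module.finBasis ℚ E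
  let d : Fin k → Fin (Module.finrank ℚ E) → ℚ := fun j => b.repr ⟨c j, hmem j⟩
  have hc : ∀ j, c j = ∑ t, (d j t : ℝ) * (b t : ℝ) := by
    intro j
    have := congrArg (Subtype.val) (b.sum_repr ⟨c j, hmem j⟩)
    simp only [AddSubmonoidClass.coe_finsetSum, Submodule.coe_smul, Rat.smul_def] at this
    exact this.symm
  let U : Set (Fin (Module.finrank ℚ E) → ℝ) :=
    ⋂ j : {j // 0 < c j}, {x | 0 < ∑ t, (d j t : ℝ) * x t}
  have hU : IsOpen U := by
    apply isOpen_iInter_of_finite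
    intro j
    exact isOpen_lt continuous_const (by fun_prop)
  have hne : U.Nonempty := by
    refine ⟨fun t => (b t : ℝ), ?_⟩
    simp only [U, Set.mem_iInter, Set.mem_ofPred_eq]
    intro j
    rw [← hc]; exact j.2
  have hD : DenseRange (Pi.map (fun _ : Fin (Module.finrank ℚ E) => ((↑) : ℚ → ℝ))) :=
    DenseRange.piMap (fun _ => Rat.denseRange_cast)
  obtain ⟨q, hq⟩ := hD.exists_mem_open hU hne
  let φ0 : E →ₗ[ℚ] ℚ := b.constr ℚ q
  obtain ⟨φ, hφ⟩ := LinearMap.exists_extend φ0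
  refine ⟨φ, fun j hj => ?_⟩
  have h1 : φ (c j) = φ0 ⟨c j, hmem j⟩ := by rw [← hφ]; rfl
  have h2 : φ0 ⟨c j, hmem j⟩ = ∑ t, d j t * q t := by
    simp [φ0, Module.Basis.constr_apply_fintype, d]
  rw [h1, h2]
  simp only [U, Set.mem_iInter, Set.mem_ofPred_eq, Pi.map_apply] at hq
  have := hq ⟨j, hj⟩
  exact_mod_cast this

lemma aux_relint {n k : ℕ} (v : Fin k → Fin n → ℝ) (J : Set (Fin k)) (c : Fin k → ℝ)
    (hc : ∀ j ∈ J, 0 < c j) (hc0 : ∀ j, j ∉ J → c j = 0) :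
    ∑ j, c j • v j ∈ intrinsicInterior ℝ (coneOfSub v J) := by
  classical
  let T : (Fin k → ℝ) →ₗ[ℝ] (Fin n → ℝ) :=
    ∑ j, if j ∈ J then (LinearMap.proj j : (Fin k → ℝ) →ₗ[ℝ] ℝ).smulRight (v j) else 0
  have hT : ∀ x, T x = ∑ j, (if j ∈ J then x j else 0) • v j := by
    intro x
    simp only [T, LinearMap.sum_apply]
    refine Finset.sum_congr rfl fun j _ => ?_
    split_ifs <;> simp
  have hTc : T c = ∑ j, c j • v j := by
    rw [hT]
    refine Finset.sum_congr rfl fun j _ => ?_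
    split_ifs with h
    · rfl
    · rw [hc0 j h]
  obtain ⟨s0, hs0⟩ := T.rangeRestrict.exists_rightInverse_of_surjective T.range_rangeRestrict
  obtain ⟨s, hs⟩ := LinearMap.exists_extend s0
  have hTs : ∀ y ∈ LinearMap.range T, T (s y) = y := by
    intro y hy
    have h1 : s y = s0 ⟨y, hy⟩ := by rw [← hs]; rfl
    have h2 := congrArg Subtype.val (LinearMap.congr_fun hs0 ⟨y, hy⟩)
    rw [h1]; exact h2
  have hsc : Continuous s := s.continuous_of_finiteDimensional
  have hmem : T c ∈ coneOfSub v J := by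
    refine ⟨c, fun i => ?_, hc0, hTc⟩
    by_cases h : i ∈ J
    · exact (hc i h).le
    · rw [hc0 i h]
  have hspan : affineSpan ℝ (coneOfSub v J) ≤ (LinearMap.range T).toAffineSubspace := by
    rw [affineSpan_le]
    rintro x ⟨a, _, ha0, rfl⟩
    refine ⟨a, ?_⟩
    rw [hT]
    refine Finset.sum_congr rfl fun j _ => ?_
    split_ifs with h
    · rfl
    · rw [ha0 j h]
  rw [← hTc, mem_intrinsicInterior]
  refine ⟨⟨T c, subset_affineSpan ℝ _ hmem⟩, ?_, rfl⟩
  rw [mem_interior]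
  refine ⟨⋂ j : J, {y | 0 < c j + s ((y : Fin n → ℝ) - T c) j}, ?_, ?_, ?_⟩
  · intro y hy
    simp only [Set.mem_iInter, Set.mem_ofPred_eq] at hy
    have hyT : (y : Fin n → ℝ) ∈ LinearMap.range T := hspan y.2
    refine ⟨fun j => if j ∈ J then c j + s ((y : Fin n → ℝ) - T c) j else 0, ?_, ?_, ?_⟩
    · intro i
      dsimp only
      split_ifs with h
      · exact (hy ⟨i, h⟩).le
      · exact le_rfl
    · intro i hi; simp [hi]
    · have h1 := hT (c + s ((y : Fin n → ℝ) - T c))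
      rw [map_add, hTs _ (Submodule.sub_mem _ hyT ⟨c, rfl⟩)] at h1
      simpa using h1
  · apply isOpen_iInter_of_finite
    intro j
    refine isOpen_lt continuous_const ?_
    have : Continuous fun y : affineSpan ℝ (coneOfSub v J) => s ((y : Fin n → ℝ) - T c) :=
      hsc.comp (by fun_prop)
    exact continuous_const.add ((continuous_apply _).comp this)
  · simp only [Set.mem_iInter, Set.mem_ofPred_eq]
    intro j
    simpa using hc j j.2

lemma aux_face_vanish {n : ℕ} (τ : Set (Fin n → ℝ)) (f : (Fin n → ℝ) →ₗ[ℝ] ℝ)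
    (hf : ∀ x ∈ τ, 0 ≤ f x) (m : Fin n → ℝ) (hm : m ∈ intrinsicInterior ℝ τ)
    (hfm : f m = 0) : ∀ y ∈ τ, f y = 0 := by
  intro y hy
  rw [mem_intrinsicInterior] at hm
  obtain ⟨p, hp, rfl⟩ := hm
  let q : affineSpan ℝ τ := ⟨y, subset_affineSpan ℝ _ hy⟩
  have hl : ∀ t : ℝ, (p : Fin n → ℝ) + t • ((p : Fin n → ℝ) - y) ∈ affineSpan ℝ τ := by
    intro t
    have := AffineMap.lineMap_mem (-t) p.2 q.2
    convert this using 1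
    simp [AffineMap.lineMap_apply, q]
    rw [← smul_neg, neg_sub, add_comm]
  let g : ℝ → affineSpan ℝ τ := fun t => ⟨_, hl t⟩
  have hg : Continuous g := by
    apply Continuous.subtype_mk
    fun_prop
  have hg0 : g 0 = p := by ext1; simp [g]
  have hev : ∀ᶠ t in nhds (0:ℝ), g t ∈ interior ((↑) ⁻¹' τ : Set (affineSpan ℝ τ)) := by
    apply hg.continuousAt.eventually_mem
    rw [hg0]
    exact isOpen_interior.mem_nhds hp
  obtain ⟨ε, hε, h⟩ := Metric.eventually_nhds_iff.1 hev
  have h1 := h (y := ε / 2) (by simp [abs_of_pos hε, hε])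
  have h2' : g (ε / 2) ∈ ((↑) ⁻¹' τ : Set (affineSpan ℝ τ)) := interior_subset h1
  have h2 := hf _ h2'
  simp only [g, map_add, map_smul, map_sub, hfm, smul_eq_mul] at h2
  have h3 := hf y hy
  nlinarith

lemma aux_face_eq {n k : ℕ} (v : Fin k → Fin n → ℝ) (f : (Fin n → ℝ) →ₗ[ℝ] ℝ)
    (hf : ∀ j, 0 ≤ f (v j)) :
    coneOf v ∩ {x | f x = 0} = coneOfSub v {j | f (v j) = 0} := by
  ext x
  constructor
  · rintro ⟨⟨c, hc, rfl⟩, hx⟩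
    refine ⟨c, hc, fun i hi => ?_, rfl⟩
    simp only [Set.mem_ofPred_eq, map_sum, map_smul, smul_eq_mul] at hx
    rw [Finset.sum_eq_zero_iff_of_nonneg (fun j _ => mul_nonneg (hc j) (hf j))] at hx
    exact (mul_eq_zero.1 (hx i (Finset.mem_univ _))).resolve_right hi
  · rintro ⟨c, hc, hc0, rfl⟩
    refine ⟨⟨c, hc, rfl⟩, ?_⟩
    simp only [Set.mem_ofPred_eq, map_sum, map_smul, smul_eq_mul]
    refine Finset.sum_eq_zero fun j _ => ?_
    by_cases h : f (v j) = 0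
    · simp [h]
    · simp [hc0 j h]

lemma aux_mem_coneOf {n k : ℕ} (v : Fin k → Fin n → ℝ) (j : Fin k) : v j ∈ coneOf v := by
  classical
  refine ⟨Pi.single j 1, fun i => ?_, ?_⟩
  · by_cases h : i = j
    · subst h; simp
    · simp [h]
  · simp [Pi.single_apply, ite_smul]

lemma aux_span_toC {n : ℕ} (W : Submodule ℂ (Fin n → ℂ)) (x : Fin n → ℝ)
    (hx : x ∈ Submodule.span ℝ (intToR '' {m : Fin n → ℤ | intToC m ∈ W})) : toC x ∈ W := by
  induction hx using Submodule.span_induction with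
  | mem x h =>
    obtain ⟨m, hm, rfl⟩ := h
    have : toC (intToR m) = intToC m := by ext i; simp [toC, intToR, intToC]
    rw [this]; exact hm
  | zero =>
    have : toC (0 : Fin n → ℝ) = 0 := by ext i; simp [toC]
    rw [this]; exact W.zero_mem
  | add x y _ _ hx hy =>
    have : toC (x + y) = toC x + toC y := by ext i; simp [toC]
    rw [this]; exact W.add_mem hx hy
  | smul a x _ hx =>
    have : toC (a • x) = (a : ℂ) • toC x := by ext i; simp [toC]
    rw [this]; exact W.smul_mem _ hx

lemma aux_toC_intToR {n : ℕ} (m : Fin n → ℤ) : toC (intToR m) = intToC m := by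
  ext i; simp [toC, intToR, intToC]

/-- A real nonnegative combination in the span can be replaced by an integral one. -/
lemma aux_integral {n k : ℕ} (v : Fin k → Fin n → ℤ) (S : Set (Fin n → ℤ)) (J : Set (Fin k))
    (c : Fin k → ℝ) (hc : ∀ j ∈ J, 0 < c j) (hc0 : ∀ j, j ∉ J → c j = 0)
    (hL : ∑ j, c j • intToR (v j) ∈ Submodule.span ℝ (intToR '' S)) :
    ∃ d : Fin k → ℤ, (∀ j ∈ J, 0 < d j) ∧ (∀ j, j ∉ J → d j = 0) ∧
      ∑ j, (d j : ℝ) • intToR (v j) ∈ Submodule.span ℝ (intToR '' S) := by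
  classical
  obtain ⟨φ, hφ⟩ := aux_exists_pos_rat c
  obtain ⟨r, hr⟩ := (Finsupp.mem_span_image_iff_linearCombination ℝ).1 hL
  obtain ⟨hrS, hr⟩ := hr
  rw [Finsupp.linearCombination_apply, Finsupp.sum] at hr
  have key : ∑ j, ((φ (c j) : ℚ) : ℝ) • intToR (v j)
      = ∑ w ∈ r.support, ((φ (r w) : ℚ) : ℝ) • intToR w := by
    ext i
    have h1 := congrArg φ (congrFun hr i)
    simp only [Finset.sum_apply, Pi.smul_apply, smul_eq_mul, intToR, map_sum] at h1 ⊢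
    have h2 : ∀ (x : ℝ) (z : ℤ), φ (x * z) = φ x * z := by
      intro x z
      have : x * (z : ℝ) = (z : ℤ) • x := by simp [mul_comm]
      rw [this, map_zsmul]; simp [mul_comm]
    simp only [h2] at h1
    exact_mod_cast h1.symm
  let N : ℕ := ∏ j, (φ (c j)).den
  have hN : 0 < N := Finset.prod_pos fun j _ => (φ (c j)).den_pos
  have hint : ∀ j, ∃ z : ℤ, (z : ℚ) = N * φ (c j) := by
    intro j
    obtain ⟨M, hM⟩ : (φ (c j)).den ∣ N := Finset.dvd_prod_of_mem _ (Finset.mem_univ j)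
    refine ⟨M * (φ (c j)).num, ?_⟩
    have := Rat.mul_den_eq_num (φ (c j))
    rw [hM]; push_cast; rw [← this]; ring
  choose d hd using hint
  refine ⟨d, ?_, ?_, ?_⟩
  · intro j hj
    have : (0 : ℚ) < d j := by
      rw [hd]; exact mul_pos (by exact_mod_cast hN) (hφ j (hc j hj))
    exact_mod_cast this
  · intro j hj
    have : (d j : ℚ) = 0 := by rw [hd, hc0 j hj]; simp
    exact_mod_cast this
  · have h3 : ∑ j, (d j : ℝ) • intToR (v j)
        = (N : ℝ) • ∑ w ∈ r.support, ((φ (r w) : ℚ) : ℝ) • intToR w := by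
      rw [← key, Finset.smul_sum]
      refine Finset.sum_congr rfl fun j _ => ?_
      rw [smul_smul]
      congr 1
      have := hd j
      exact_mod_cast congrArg (fun q : ℚ => (q : ℝ)) this
    rw [h3]
    refine Submodule.smul_mem _ _ (Submodule.sum_mem _ fun w hw => Submodule.smul_mem _ _ ?_)
    exact Submodule.subset_span ⟨w, hrS hw, rfl⟩

/-- Exposing functional for the generators indexed by `J`. -/
lemma aux_expose {n k : ℕ} (v : Fin k → Fin n → ℝ) (J : Set (Fin k))
    (hJ : ∀ a : Fin k → ℝ, (∀ i, i ∉ J → 0 ≤ a i) → ∑ i, a i • v i = 0 → ∀ i, i ∉ J → a i = 0) :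
    ∃ f : (Fin n → ℝ) →ₗ[ℝ] ℝ, (∀ j ∈ J, f (v j) = 0) ∧ ∀ j, j ∉ J → 0 < f (v j) := by
  classical
  let A : Set (Fin n → ℝ) := convexHull ℝ (v '' Jᶜ)
  let B : Submodule ℝ (Fin n → ℝ) := Submodule.span ℝ (v '' J)
  have hA : IsCompact A := (Set.toFinite (v '' Jᶜ)).isCompact_convexHull ℝ
  have hB : IsClosed (B : Set (Fin n → ℝ)) := B.closed_of_finiteDimensional
  have hdis : Disjoint A (B : Set (Fin n → ℝ)) := by
    rw [Set.disjoint_left]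
    intro x hxA hxB
    have hA2 : ∃ a : Fin k → ℝ, (∀ i, 0 ≤ a i) ∧ (∀ i ∈ J, a i = 0) ∧ ∑ i, a i = 1 ∧
        ∑ i, a i • v i = x := by
      have hsub : A ⊆ {x | ∃ a : Fin k → ℝ, (∀ i, 0 ≤ a i) ∧ (∀ i ∈ J, a i = 0) ∧ ∑ i, a i = 1 ∧
        ∑ i, a i • v i = x} := by
        apply convexHull_min
        · rintro _ ⟨j, hj, rfl⟩
          refine ⟨Pi.single j 1, fun i => ?_, fun i hi => ?_, by simp, by simp [Pi.single_apply, ite_smul]⟩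
          · by_cases h : i = j
            · subst h; simp
            · simp [h]
          · have : i ≠ j := by rintro rfl; exact hj hi
            simp [this]
        · rintro _ ⟨a, ha, ha0, ha1, rfl⟩ _ ⟨b, hb, hb0, hb1, rfl⟩ s t hs ht hst
          refine ⟨s • a + t • b, fun i => ?_, fun i hi => ?_, ?_, ?_⟩
          · have := mul_nonneg hs (ha i)
            have := mul_nonneg ht (hb i)
            simp; positivity
          · simp [ha0 i hi, hb0 i hi]
          · simp [Finset.sum_add_distrib, ← Finset.mul_sum, ha1, hb1, hst]
          · simp [Finset.sum_add_distrib, add_smul, Finset.smul_sum, smul_smul]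
      exact hsub hxA
    obtain ⟨a, ha, ha0, ha1, hax⟩ := hA2
    obtain ⟨r, hrS, hr⟩ := (Finsupp.mem_span_image_iff_linearCombination ℝ).1 hxB
    have hr' : ∑ i, r i • v i = x := by
      rw [← hr, Finsupp.linearCombination_apply, Finsupp.sum_fintype _ _ (by simp)]
    have hr0 : ∀ i, i ∉ J → r i = 0 := fun i hi => by
      by_contra h
      exact hi (hrS (Finsupp.mem_support_iff.2 h))
    have h0 := hJ (fun i => a i - r i) (fun i hi => by simp [hr0 i hi, ha i])
      (by simp [sub_smul, Finset.sum_sub_distrib, hax, hr'])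
    have : ∑ i, a i = 0 := Finset.sum_eq_zero fun i _ => by
      by_cases h : i ∈ J
      · exact ha0 i h
      · simpa [hr0 i h] using h0 i h
    rw [ha1] at this
    exact one_ne_zero this
  obtain ⟨f, u, w, hfa, huw, hfb⟩ :=
    geometric_hahn_banach_compact_closed (convex_convexHull ℝ _) hA B.convex hB hdis
  have hw0 : w < 0 := by simpa using hfb 0 B.zero_mem
  refine ⟨-(f : (Fin n → ℝ) →ₗ[ℝ] ℝ), fun j hj => ?_, fun j hj => ?_⟩
  · have hm : v j ∈ B := Submodule.subset_span ⟨j, hj, rfl⟩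
    by_contra h
    have h' : f (v j) ≠ 0 := by simpa using h
    have := hfb ((w / f (v j)) • v j) (B.smul_mem _ hm)
    rw [map_smul, smul_eq_mul, div_mul_cancel₀ _ h'] at this
    exact lt_irrefl _ this
  · have := hfa (v j) (subset_convexHull ℝ _ ⟨j, hj, rfl⟩)
    simp; linarith

lemma aux_sum_int {n k : ℕ} (v : Fin k → Fin n → ℤ) (d : Fin k → ℤ) :
    intToR (∑ j, d j • v j) = ∑ j, (d j : ℝ) • intToR (v j) := by
  ext i; simp [intToR, Finset.sum_apply]

/-- For a strongly convex rational polyhedral cone `σ` and a proper complex subspace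
`W ⊊ ℂⁿ`, condition (†) for all faces of `σ` is equivalent to `span_ℝ(W ∩ ℤⁿ) ∩ σ`
being a face of `σ`. -/
theorem dagger_iff_span_lattice_inter_isFace (n k : ℕ) (v : Fin k → Fin n → ℤ)
    (σ : Set (Fin n → ℝ)) (hσ : σ = coneOf fun i => intToR (v i))
    (W : Submodule ℂ (Fin n → ℂ)) (hW : W ≠ ⊤)
    (hsc : ∀ x ∈ σ, -x ∈ σ → x = (0 : Fin n → ℝ)) :
    (∀ τ : Set (Fin n → ℝ), IsFaceOf τ σ →
        (relintMeetsLattice τ W ↔ subsetW τ W)) ↔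
      IsFaceOf
        (((Submodule.span ℝ (intToR '' {m : Fin n → ℤ | intToC m ∈ W}) :
            Submodule ℝ (Fin n → ℝ)) : Set (Fin n → ℝ)) ∩ σ) σ := by
  classical
  clear hW hsc
  subst hσ
  set V : Fin k → Fin n → ℝ := fun i => intToR (v i) with hV
  set L := Submodule.span ℝ (intToR '' {m : Fin n → ℤ | intToC m ∈ W}) with hL
  constructor
  · intro H
    let J : Set (Fin k) := {i | ∃ c : Fin k → ℝ, (∀ j, 0 ≤ c j) ∧ 0 < c i ∧ ∑ j, c j • V j ∈ L}
    have hJ : ∀ i, ∃ c : Fin k → ℝ, (∀ j, 0 ≤ c j) ∧ (i ∈ J → 0 < c i) ∧ ∑ j, c j • V j ∈ L := by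
      intro i
      by_cases h : i ∈ J
      · obtain ⟨c, h1, h2, h3⟩ := h
        exact ⟨c, h1, fun _ => h2, h3⟩
      · exact ⟨0, by simp, fun h' => (h h').elim, by simp⟩
    choose C hC0 hCpos hCL using hJ
    let c : Fin k → ℝ := ∑ i, C i
    have hcV : ∑ j, c j • V j ∈ L := by
      have : ∑ j, c j • V j = ∑ i, ∑ j, C i j • V j := by
        rw [Finset.sum_comm]
        refine Finset.sum_congr rfl fun j _ => ?_
        simp [c, Finset.sum_smul]
      rw [this]
      exact Submodule.sum_mem _ fun i _ => hCL i
    have hc : ∀ j ∈ J, 0 < c j := by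
      intro j hj
      simp only [c, Finset.sum_apply]
      exact Finset.sum_pos' (fun i _ => hC0 i j) ⟨j, Finset.mem_univ _, hCpos j hj⟩
    have hcn : ∀ j, 0 ≤ c j := fun j => by
      simp only [c, Finset.sum_apply]
      exact Finset.sum_nonneg fun i _ => hC0 i j
    have hc0 : ∀ j, j ∉ J → c j = 0 := by
      intro j hj
      by_contra h
      exact hj ⟨c, hcn, lt_of_le_of_ne (hcn j) (Ne.symm h), hcV⟩
    obtain ⟨d, hd, hd0, hdL⟩ := aux_integral v _ J c hc hc0 hcV
    have hdR : ∀ j ∈ J, (1 : ℝ) ≤ d j := fun j hj => by exact_mod_cast hd j hj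
    have hdn : ∀ j, (0 : ℝ) ≤ d j := fun j => by
      by_cases h : j ∈ J
      · linarith [hdR j h]
      · rw [hd0 j h]; simp
    obtain ⟨f, hf0, hfpos⟩ := aux_expose V J (by
      intro a ha hsum i hi
      by_contra hne
      apply hi
      let M : ℝ := ∑ j, |a j|
      have hM : ∀ j, |a j| ≤ M := fun j =>
        Finset.single_le_sum (f := fun j => |a j|) (fun _ _ => abs_nonneg _) (Finset.mem_univ j)
      have hM0 : 0 ≤ M := Finset.sum_nonneg fun _ _ => abs_nonneg _
      refine ⟨fun j => a j + M * d j, fun j => ?_, ?_, ?_⟩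
      · by_cases h : j ∈ J
        · have h1 := hM j
          have h2 := neg_abs_le (a j)
          have h3 := mul_le_mul_of_nonneg_left (hdR j h) hM0
          dsimp only; linarith
        · exact add_nonneg (ha j h) (mul_nonneg hM0 (hdn j))
      · exact add_pos_of_pos_of_nonneg (lt_of_le_of_ne (ha i hi) (Ne.symm hne))
          (mul_nonneg hM0 (hdn i))
      · have : ∑ j, (a j + M * d j) • V j = M • ∑ j, (d j : ℝ) • V j := by
          simp only [add_smul, Finset.sum_add_distrib, hsum, zero_add, Finset.smul_sum, smul_smul]
        rw [this]
        exact L.smul_mem _ hdL)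
    have hfn : ∀ j, 0 ≤ f (V j) := fun j => by
      by_cases h : j ∈ J
      · rw [hf0 j h]
      · exact (hfpos j h).le
    have hJf : {j | f (V j) = 0} = J := by
      ext j
      refine ⟨fun h => ?_, fun h => hf0 j h⟩
      by_contra h'
      exact (hfpos j h').ne' h
    have hface := aux_face_eq V f hfn
    rw [hJf] at hface
    have hfσ : ∀ x ∈ coneOf V, 0 ≤ f x := by
      rintro x ⟨c, hc, rfl⟩
      simp only [map_sum, map_smul, smul_eq_mul]
      exact Finset.sum_nonneg fun j _ => mul_nonneg (hc j) (hfn j)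
    have hτ : IsFaceOf (coneOfSub V J) (coneOf V) := ⟨f, hfσ, hface.symm⟩
    have hsub := (H _ hτ).1 ⟨∑ j, d j • v j, by
      rw [aux_sum_int]
      exact aux_relint V J (fun j => (d j : ℝ)) (fun j hj => by exact_mod_cast hd j hj)
        (fun j hj => by simp [hd0 j hj]), by
      rw [← aux_toC_intToR, aux_sum_int]
      exact aux_span_toC W _ hdL⟩
    refine ⟨f, hfσ, ?_⟩
    rw [hface]
    have hVL : ∀ j ∈ J, V j ∈ L := by
      intro j hj
      refine Submodule.subset_span ⟨v j, ?_, rfl⟩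
      have : V j ∈ coneOfSub V J := by
        rw [← hface]
        exact ⟨aux_mem_coneOf V j, hf0 j hj⟩
      have := hsub _ this
      rwa [hV, aux_toC_intToR] at this
    ext x
    constructor
    · rintro ⟨hxL, a, ha, rfl⟩
      refine ⟨a, ha, fun i hi => ?_, rfl⟩
      by_contra h
      exact hi ⟨a, ha, lt_of_le_of_ne (ha i) (Ne.symm h), hxL⟩
    · rintro ⟨a, ha, ha0, rfl⟩
      refine ⟨?_, a, ha, rfl⟩
      refine Submodule.sum_mem _ fun j _ => ?_
      by_cases h : j ∈ J
      · exact L.smul_mem _ (hVL j h)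
      · rw [ha0 j h, zero_smul]; exact L.zero_mem
  · rintro ⟨g, hg, hgL⟩ τ ⟨f, hf, rfl⟩
    constructor
    · rintro ⟨m, hm, hmW⟩ x hx
      have hmL : intToR m ∈ L := Submodule.subset_span ⟨m, hmW, rfl⟩
      have hmσ := (intrinsicInterior_subset hm).1
      have hgm : g (intToR m) = 0 := by
        have : intToR m ∈ (L : Set (Fin n → ℝ)) ∩ coneOf V := ⟨hmL, hmσ⟩
        rw [hgL] at this
        exact this.2
      have hgx := aux_face_vanish _ g (fun y hy => hg y hy.1) _ hm hgm x hx
      have : x ∈ (L : Set (Fin n → ℝ)) ∩ coneOf V := by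
        rw [hgL]; exact ⟨hx.1, hgx⟩
      exact aux_span_toC W x this.1
    · intro h
      have hfn : ∀ j, 0 ≤ f (V j) := fun j => hf _ (aux_mem_coneOf V j)
      rw [aux_face_eq V f hfn] at h ⊢
      let d : Fin k → ℤ := fun j => if f (V j) = 0 then 1 else 0
      have hm : ∑ j, (d j : ℝ) • V j ∈ intrinsicInterior ℝ (coneOfSub V {j | f (V j) = 0}) := by
        apply aux_relint V _ (fun j => (d j : ℝ))
        · intro j hj
          have : f (V j) = 0 := hj
          simp [d, this]
        · intro j hj
          have : ¬ f (V j) = 0 := hj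
          simp [d, this]
      refine ⟨∑ j, d j • v j, ?_, ?_⟩
      · rw [aux_sum_int]; exact hm
      · rw [← aux_toC_intToR, aux_sum_int]
        exact h _ (intrinsicInterior_subset hm)
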